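/- arXiv:2203.04485 — 2 statements merged into one kernel-verified Lean document; each statement's English description precedes it below -/
import Mathlib

section
/- Composite Ville's theorem: for an arbitrary subset A ⊆ Ω, one has μ*(A) = 0 if and only if there exists a 𝒫-e-process (E_t)_{t ∈ ℕ} such that lim_{t→∞} E_t(ω) = ∞ for every ω ∈ A. -/
open MeasureTheory Filter ENNReal

/-- A stopping time with values in `ℕ∞ = ℕ ∪ {∞}` with respect to a filtration `F`:
`{ω | τ ω ≤ t}` is `F t`-measurable for every `t ∈ ℕ`. -/
def IsStopTime {Ω : Type*} {m : MeasurableSpace Ω} (F : Filtration ℕ m) (τ : Ω → ℕ∞) : Prop :=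
  ∀ t : ℕ, MeasurableSet[F t] {ω | τ ω ≤ (t : ℕ∞)}

/-- The inverse-capital outer measure associated with a family `Ps` of measures:
`μ*(A) = inf { sup_{P ∈ Ps} P(τ < ∞) : τ a stopping time with A ⊆ {τ < ∞} }`. -/
noncomputable def invCap {Ω : Type*} {m : MeasurableSpace Ω} (F : Filtration ℕ m)
    (Ps : Set (Measure Ω)) (A : Set Ω) : ℝ≥0∞ :=
  ⨅ (τ : Ω → ℕ∞) (_ : IsStopTime F τ ∧ A ⊆ {ω | τ ω ≠ ⊤}),
    ⨆ P ∈ Ps, P {ω | τ ω ≠ ⊤}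


/-- The value `E_τ` of a process at a stopping time `τ`, defined as `limsup_{t→∞} E_t`
on the event `{τ = ∞}`. -/
noncomputable def stopVal {Ω : Type*} (E : ℕ → Ω → ℝ≥0∞) (τ : Ω → ℕ∞) (ω : Ω) : ℝ≥0∞ :=
  if h : τ ω = ⊤ then Filter.limsup (fun t => E t ω) Filter.atTop
  else E ((τ ω).untop h) ω

/-- A `Ps`-e-process: a `[0,∞)`-valued adapted process `E` such that `∫ E_τ dP ≤ 1` for every
`P ∈ Ps` and every stopping time `τ`. -/
def IsEProcess {Ω : Type*} {m : MeasurableSpace Ω} (F : Filtration ℕ m)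
    (Ps : Set (Measure Ω)) (E : ℕ → Ω → ℝ≥0∞) : Prop :=
  (∀ t ω, E t ω ≠ ⊤) ∧ (∀ t, Measurable[F t] (E t)) ∧
    ∀ P ∈ Ps, ∀ τ : Ω → ℕ∞, IsStopTime F τ → ∫⁻ ω, stopVal E τ ω ∂P ≤ 1

section

variable {Ω : Type*} {m : MeasurableSpace Ω} {F : Filtration ℕ m}

lemma IsStopTime.measurableSet_ne_top {τ : Ω → ℕ∞} (hτ : IsStopTime F τ) :
    MeasurableSet {ω | τ ω ≠ ⊤} := by
  have h : {ω | τ ω ≠ ⊤} = ⋃ t : ℕ, {ω | τ ω ≤ (t : ℕ∞)} := by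
    ext ω
    simp only [Set.mem_ofPred_eq, Set.mem_iUnion]
    refine ⟨fun h => ?_, fun ⟨t, ht⟩ => ne_top_of_le_ne_top (ENat.natCast_ne_top t) ht⟩
    obtain ⟨t, ht⟩ := ENat.ne_top_iff_exists.mp h
    exact ⟨t, ht.ge⟩
  rw [h]
  exact MeasurableSet.iUnion fun t => F.le t _ (hτ t)

open Classical in
/-- The first time at which the process `E` is at least `c`. -/
noncomputable def firstPassage (E : ℕ → Ω → ℝ≥0∞) (c : ℝ≥0∞) (ω : Ω) : ℕ∞ :=
  if h : ∃ t, c ≤ E t ω then ((Nat.find h : ℕ) : ℕ∞) else ⊤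

lemma firstPassage_le_iff (E : ℕ → Ω → ℝ≥0∞) (c : ℝ≥0∞) (ω : Ω) (t : ℕ) :
    firstPassage E c ω ≤ t ↔ ∃ s ≤ t, c ≤ E s ω := by
  classical
  unfold firstPassage
  split_ifs with h
  · rw [Nat.cast_le, Nat.find_le_iff]
  · simp only [top_le_iff, ENat.natCast_ne_top, false_iff]
    rintro ⟨s, -, hs⟩
    exact h ⟨s, hs⟩

lemma isStopTime_firstPassage {E : ℕ → Ω → ℝ≥0∞} (hE : ∀ t, Measurable[F t] (E t)) (c : ℝ≥0∞) :
    IsStopTime F (firstPassage E c) := by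
  intro t
  have h : {ω | firstPassage E c ω ≤ (t : ℕ∞)} = ⋃ s ∈ Set.Iic t, {ω | c ≤ E s ω} := by
    ext ω
    simp [firstPassage_le_iff]
  rw [h]
  refine MeasurableSet.biUnion (Set.to_countable _) fun s hs => F.mono hs _ ?_
  exact hE s measurableSet_Ici

lemma le_stopVal_firstPassage {E : ℕ → Ω → ℝ≥0∞} {c : ℝ≥0∞} {ω : Ω}
    (h : firstPassage E c ω ≠ ⊤) : c ≤ stopVal E (firstPassage E c) ω := by
  classical
  have hex : ∃ t, c ≤ E t ω := by
    by_contra hn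
    exact h (dif_neg hn)
  have heq : firstPassage E c ω = ((Nat.find hex : ℕ) : ℕ∞) := dif_pos hex
  have huntop : (firstPassage E c ω).untop h = Nat.find hex := by
    simp only [heq]
    rfl
  rw [stopVal, dif_neg h, huntop]
  exact Nat.find_spec hex

/-- Ville's inequality for e-processes. -/
lemma IsEProcess.measure_firstPassage_le {Ps : Set (Measure Ω)} {E : ℕ → Ω → ℝ≥0∞}
    (hE : IsEProcess F Ps E) {P : Measure Ω} (hP : P ∈ Ps) (c : ℝ≥0∞) :
    c * P {ω | firstPassage E c ω ≠ ⊤} ≤ 1 := by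
  have hτ := isStopTime_firstPassage hE.2.1 c
  rw [← lintegral_indicator_const hτ.measurableSet_ne_top]
  refine (lintegral_mono fun ω => ?_).trans (hE.2.2 P hP _ hτ)
  exact Set.indicator_apply_le fun h => le_stopVal_firstPassage h

/-- The number of indices `n < t` such that `τ n` has occurred by time `t`. -/
noncomputable def countStopped (τ : ℕ → Ω → ℕ∞) (t : ℕ) (ω : Ω) : ℝ≥0∞ :=
  ∑ n ∈ Finset.range t, {ω | τ n ω ≤ (t : ℕ∞)}.indicator 1 ω

lemma countStopped_ne_top (τ : ℕ → Ω → ℕ∞) (t : ℕ) (ω : Ω) : countStopped τ t ω ≠ ⊤ := by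
  refine ENNReal.sum_ne_top.mpr fun n _ => ne_top_of_le_ne_top one_ne_top ?_
  exact Set.indicator_apply_le' (fun _ => le_rfl) fun _ => zero_le

lemma measurable_countStopped {τ : ℕ → Ω → ℕ∞} (hτ : ∀ n, IsStopTime F (τ n)) (t : ℕ) :
    Measurable[F t] (countStopped τ t) :=
  Finset.measurable_sum _ fun n _ => (measurable_const (a := (1 : ℝ≥0∞))).indicator (hτ n t)

lemma countStopped_le_tsum (τ : ℕ → Ω → ℕ∞) (t : ℕ) (ω : Ω) :
    countStopped τ t ω ≤ ∑' n, {ω | τ n ω ≠ ⊤}.indicator 1 ω := by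
  refine le_trans (Finset.sum_le_sum fun n _ => ?_) (ENNReal.sum_le_tsum (Finset.range t))
  refine Set.indicator_le_indicator_of_subset (fun ω h => ?_) (fun _ => zero_le) ω
  exact ne_top_of_le_ne_top (ENat.natCast_ne_top t) h

lemma stopVal_le {E : ℕ → Ω → ℝ≥0∞} {ω : Ω} {b : ℝ≥0∞} (h : ∀ t, E t ω ≤ b) (τ : Ω → ℕ∞) :
    stopVal E τ ω ≤ b := by
  unfold stopVal
  split_ifs
  · exact limsup_le_of_le (h := Eventually.of_forall h)
  · exact h _

lemma isEProcess_countStopped {Ps : Set (Measure Ω)} {τ : ℕ → Ω → ℕ∞}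
    (hτ : ∀ n, IsStopTime F (τ n)) (hsum : ∀ P ∈ Ps, ∑' n, P {ω | τ n ω ≠ ⊤} ≤ 1) :
    IsEProcess F Ps (countStopped τ) := by
  refine ⟨countStopped_ne_top τ, measurable_countStopped hτ, fun P hP σ _ => ?_⟩
  calc ∫⁻ ω, stopVal (countStopped τ) σ ω ∂P
      ≤ ∫⁻ ω, ∑' n, {ω | τ n ω ≠ ⊤}.indicator 1 ω ∂P :=
        lintegral_mono fun ω => stopVal_le (fun t => countStopped_le_tsum τ t ω) σ
    _ = ∑' n, P {ω | τ n ω ≠ ⊤} := by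
        rw [lintegral_tsum fun n =>
          (measurable_one.indicator (hτ n).measurableSet_ne_top).aemeasurable]
        exact tsum_congr fun n => lintegral_indicator_one (hτ n).measurableSet_ne_top
    _ ≤ 1 := hsum P hP

lemma tendsto_countStopped {τ : ℕ → Ω → ℕ∞} {ω : Ω} (h : ∀ n, τ n ω ≠ ⊤) :
    Tendsto (fun t => countStopped τ t ω) atTop (nhds ⊤) := by
  rw [ENNReal.tendsto_nhds_top_iff_nat]
  intro N
  have hev : ∀ᶠ t : ℕ in atTop, ∀ n ∈ Finset.range (N + 1), τ n ω ≤ (t : ℕ∞) := by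
    rw [Finset.eventually_all]
    intro n _
    obtain ⟨k, hk⟩ := ENat.ne_top_iff_exists.mp (h n)
    filter_upwards [eventually_ge_atTop k] with t ht
    rw [← hk]
    exact_mod_cast ht
  filter_upwards [hev, eventually_ge_atTop (N + 1)] with t ht hNt
  calc (N : ℝ≥0∞) < ((N + 1 : ℕ) : ℝ≥0∞) := by exact_mod_cast N.lt_succ_self
    _ = ∑ n ∈ Finset.range (N + 1), {ω | τ n ω ≤ (t : ℕ∞)}.indicator 1 ω := by
        rw [Finset.sum_congr rfl fun n hn =>
          Set.indicator_of_mem (s := {ω | τ n ω ≤ (t : ℕ∞)}) (ht n hn) 1]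
        simp
    _ ≤ countStopped τ t ω := Finset.sum_le_sum_of_subset (Finset.range_mono hNt)

lemma exists_isStopTime_of_invCap_lt {Ps : Set (Measure Ω)} {A : Set Ω} {ε : ℝ≥0∞}
    (h : invCap F Ps A < ε) :
    ∃ τ, IsStopTime F τ ∧ A ⊆ {ω | τ ω ≠ ⊤} ∧ ∀ P ∈ Ps, P {ω | τ ω ≠ ⊤} ≤ ε := by
  simp only [invCap, iInf_lt_iff] at h
  obtain ⟨τ, ⟨hτ, hA⟩, hlt⟩ := h
  exact ⟨τ, hτ, hA, fun P hP => (le_iSup₂ (f := fun P _ => P {ω | τ ω ≠ ⊤}) P hP).trans hlt.le⟩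

end

/-- Composite Ville's theorem: `μ*(A) = 0` iff there is a `Ps`-e-process tending to `∞` on `A`. -/
theorem composite_ville {Ω : Type*} {m : MeasurableSpace Ω} (F : Filtration ℕ m)
    (hgen : m = ⨆ t : ℕ, (F t : MeasurableSpace Ω))
    (Ps : Set (Measure Ω)) (hprob : ∀ P ∈ Ps, IsProbabilityMeasure P) (A : Set Ω) :
    invCap F Ps A = 0 ↔
      ∃ E : ℕ → Ω → ℝ≥0∞, IsEProcess F Ps E ∧
        ∀ ω ∈ A, Filter.Tendsto (fun t => E t ω) Filter.atTop (nhds ⊤) := by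
  constructor
  · intro h
    have hlt (n : ℕ) : invCap F Ps A < (2⁻¹ : ℝ≥0∞) ^ (n + 1) := by
      rw [h]
      exact ENNReal.pow_pos (by simp) _
    choose τ hτ hA hP using fun n => exists_isStopTime_of_invCap_lt (hlt n)
    refine ⟨countStopped τ, isEProcess_countStopped hτ fun P hPs => ?_,
      fun ω hω => tendsto_countStopped fun n => hA n hω⟩
    calc ∑' n, P {ω | τ n ω ≠ ⊤} ≤ ∑' n : ℕ, (2⁻¹ : ℝ≥0∞) ^ (n + 1) :=
          ENNReal.tsum_le_tsum fun n => hP n P hPs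
      _ = 1 := by
          rw [ENNReal.tsum_geometric_add_one, ENNReal.one_sub_inv_two, inv_inv,
            ENNReal.inv_mul_cancel two_ne_zero ofNat_ne_top]
  · rintro ⟨E, hE, hA⟩
    have key (n : ℕ) : invCap F Ps A ≤ (n : ℝ≥0∞)⁻¹ := by
      refine iInf₂_le_of_le (firstPassage E n)
        ⟨isStopTime_firstPassage hE.2.1 n, fun ω hω => ?_⟩ (iSup₂_le fun P hP => ?_)
      · obtain ⟨t, ht⟩ := (ENNReal.tendsto_nhds_top_iff_nat.mp (hA ω hω) n).exists
        exact ne_top_of_le_ne_top (ENat.natCast_ne_top t)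
          ((firstPassage_le_iff E n ω t).mpr ⟨t, le_rfl, ht.le⟩)
      · rw [ENNReal.le_inv_iff_mul_le, mul_comm]
        exact hE.measure_firstPassage_le hP n
    exact le_antisymm (ge_of_tendsto' ENNReal.tendsto_inv_nat_nhds_zero key) (zero_le)
end

section
/- An unbounded supremum suffices: if there exists a 𝒫-e-process (E_t)_{t ∈ ℕ} such that sup_{t ∈ ℕ} E_t(ω) = ∞ for every ω in a subset A ⊆ Ω, then there exists a (possibly different) 𝒫-e-process (E'_t)_{t ∈ ℕ} such that lim_{t→∞} E'_t(ω) = ∞ for every ω ∈ A. -/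
open MeasureTheory Filter ENNReal

/-- The first time at which the process `E` reaches the level `c`. -/
noncomputable def hitTime {Ω : Type*} (E : ℕ → Ω → ℝ≥0∞) (c : ℝ≥0∞) (ω : Ω) : ℕ∞ :=
  open Classical in if h : ∃ s, c ≤ E s ω then (Nat.find h : ℕ∞) else ⊤

/-- The number of levels `2, 4, 8, …` that the process `E` has reached by time `t`. -/
noncomputable def levelCount {Ω : Type*} (E : ℕ → Ω → ℝ≥0∞) (t : ℕ) (ω : Ω) : ℝ≥0∞ :=
  ∑' k : ℕ, {ω | ∃ s ≤ t, 2 ^ (k + 1) ≤ E s ω}.indicator 1 ω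

section

variable {Ω : Type*} {m : MeasurableSpace Ω} {F : Filtration ℕ m} {E : ℕ → Ω → ℝ≥0∞}

theorem measurableSet_exists_le_reach (hE : ∀ t, Measurable[F t] (E t)) (c : ℝ≥0∞) (t : ℕ) :
    MeasurableSet[F t] {ω | ∃ s ≤ t, c ≤ E s ω} := by
  have : {ω | ∃ s ≤ t, c ≤ E s ω} = ⋃ s ∈ Set.Iic t, E s ⁻¹' Set.Ici c := by
    ext ω; simp
  rw [this]
  exact MeasurableSet.biUnion (Set.to_countable _) fun s hs =>
    F.mono hs _ (hE s measurableSet_Ici)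

theorem measurableSet_exists_reach (hE : ∀ t, Measurable[F t] (E t)) (c : ℝ≥0∞) :
    MeasurableSet {ω | ∃ s, c ≤ E s ω} := by
  simp only [Set.ofPred_exists]
  exact MeasurableSet.iUnion fun s => F.le s _ (hE s measurableSet_Ici)

theorem isStopTime_hitTime (hE : ∀ t, Measurable[F t] (E t)) (c : ℝ≥0∞) :
    IsStopTime F (hitTime E c) := by
  intro t
  convert measurableSet_exists_le_reach hE c t using 1
  ext ω
  by_cases h : ∃ s, c ≤ E s ω
  · simp [hitTime, h, Nat.find_le_iff]
  · have h' : ∀ s ≤ t, ¬ c ≤ E s ω := fun s _ hs => h ⟨s, hs⟩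
    simpa [hitTime, h] using h'

theorem le_stopVal_hitTime {c : ℝ≥0∞} {ω : Ω} (h : ∃ s, c ≤ E s ω) :
    c ≤ stopVal E (hitTime E c) ω := by
  classical
  have hτ : hitTime E c ω = (Nat.find h : ℕ∞) := by simp [hitTime, h]
  have hne : hitTime E c ω ≠ ⊤ := by simp [hτ]
  have hval : (hitTime E c ω).untop hne = Nat.find h := by
    simp only [hτ]
    rfl
  rw [stopVal, dif_neg hne, hval]
  exact Nat.find_spec h

/-- Ville's inequality for e-processes. -/
theorem IsEProcess.mul_measure_exists_le {Ps : Set (Measure Ω)} (hE : IsEProcess F Ps E)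
    {P : Measure Ω} (hP : P ∈ Ps) (c : ℝ≥0∞) : c * P {ω | ∃ s, c ≤ E s ω} ≤ 1 := by
  rw [← lintegral_indicator_const (measurableSet_exists_reach hE.2.1 c)]
  refine (lintegral_mono fun ω => ?_).trans (hE.2.2 P hP _ (isStopTime_hitTime hE.2.1 c))
  exact Set.indicator_apply_le fun h => le_stopVal_hitTime h

theorem stopVal_le_of_forall_le {τ : Ω → ℕ∞} {ω : Ω} {b : ℝ≥0∞} (h : ∀ t, E t ω ≤ b) :
    stopVal E τ ω ≤ b := by
  unfold stopVal
  split_ifs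
  · exact limsup_le_of_le (h := Eventually.of_forall h)
  · exact h _

theorem tsum_two_inv_pow_succ : ∑' k : ℕ, (2⁻¹ : ℝ≥0∞) ^ (k + 1) = 1 := by
  rw [ENNReal.tsum_geometric_add_one, ENNReal.one_sub_inv_two, inv_inv,
    ENNReal.inv_mul_cancel (by simp) (by simp)]

theorem levelCount_ne_top {ω : Ω} (h : ∀ t, E t ω ≠ ⊤) (t : ℕ) : levelCount E t ω ≠ ⊤ := by
  have hle : levelCount E t ω ≤
      ∑' k : ℕ, (∑ s ∈ Finset.range (t + 1), E s ω) * (2⁻¹ : ℝ≥0∞) ^ (k + 1) := by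
    refine ENNReal.tsum_le_tsum fun k => Set.indicator_apply_le' ?_ fun _ => zero_le
    rintro ⟨s, hs, hks⟩
    have hsum : (2 : ℝ≥0∞) ^ (k + 1) ≤ ∑ s ∈ Finset.range (t + 1), E s ω :=
      hks.trans (Finset.single_le_sum (f := fun s => E s ω) (fun _ _ => zero_le)
        (Finset.mem_range.2 (Nat.lt_succ_of_le hs)))
    rw [← ENNReal.inv_pow, ← div_eq_mul_inv,
      ENNReal.le_div_iff_mul_le (by simp) (by simp)]
    simpa using hsum
  refine ne_top_of_le_ne_top ?_ hle
  rw [ENNReal.tsum_mul_left, tsum_two_inv_pow_succ, mul_one]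
  exact ENNReal.sum_ne_top.2 fun s _ => h s

theorem IsEProcess.levelCount {Ps : Set (Measure Ω)} (hE : IsEProcess F Ps E) :
    IsEProcess F Ps (levelCount E) := by
  refine ⟨fun t ω => levelCount_ne_top (fun s => hE.1 s ω) t, fun t => ?_, fun P hP τ _ => ?_⟩
  · exact @Measurable.tsum Ω _ _ (F t) _ _ _ _ _ _ _ _ _ _ _ _ fun k =>
      Measurable.indicator (m := F t) measurable_const (measurableSet_exists_le_reach hE.2.1 _ t)
  · calc ∫⁻ ω, stopVal (_root_.levelCount E) τ ω ∂P
        ≤ ∫⁻ ω, ∑' k : ℕ, {ω | ∃ s, 2 ^ (k + 1) ≤ E s ω}.indicator 1 ω ∂P := by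
          refine lintegral_mono fun ω => stopVal_le_of_forall_le fun t =>
            ENNReal.tsum_le_tsum fun k => ?_
          exact Set.indicator_le_indicator_of_subset (by rintro _ ⟨s, _, hs⟩; exact ⟨s, hs⟩)
            (fun _ => zero_le) ω
      _ = ∑' k : ℕ, P {ω | ∃ s, 2 ^ (k + 1) ≤ E s ω} := by
          rw [lintegral_tsum fun k => (measurable_one.indicator
            (measurableSet_exists_reach hE.2.1 _)).aemeasurable]
          simp_rw [lintegral_indicator_one (measurableSet_exists_reach hE.2.1 _)]
      _ ≤ ∑' k : ℕ, (2⁻¹ : ℝ≥0∞) ^ (k + 1) := by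
          refine ENNReal.tsum_le_tsum fun k => ?_
          rw [← ENNReal.inv_pow, ENNReal.le_inv_iff_mul_le, mul_comm]
          exact hE.mul_measure_exists_le hP _
      _ = 1 := tsum_two_inv_pow_succ

theorem tendsto_levelCount {ω : Ω} (h : ⨆ t, E t ω = ⊤) :
    Tendsto (fun t => levelCount E t ω) atTop (nhds ⊤) := by
  rw [ENNReal.tendsto_nhds_top_iff_nat]
  intro n
  obtain ⟨s, hs⟩ := iSup_eq_top.1 h (2 ^ (n + 1)) (ENNReal.pow_lt_top ENNReal.ofNat_lt_top)
  filter_upwards [eventually_ge_atTop s] with t ht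
  have hind : ∀ k ∈ Finset.range (n + 1),
      {ω | ∃ s ≤ t, (2 : ℝ≥0∞) ^ (k + 1) ≤ E s ω}.indicator (1 : Ω → ℝ≥0∞) ω = 1 := by
    intro k hk
    have hle : (2 : ℝ≥0∞) ^ (k + 1) ≤ 2 ^ (n + 1) :=
      pow_le_pow_right₀ (by norm_num) (Finset.mem_range.1 hk)
    exact Set.indicator_of_mem (Set.mem_ofPred.2 ⟨s, ht, hle.trans hs.le⟩) _
  calc (n : ℝ≥0∞) < (n + 1 : ℕ) := by exact_mod_cast n.lt_succ_self
    _ = ∑ k ∈ Finset.range (n + 1), {ω | ∃ s ≤ t, (2 : ℝ≥0∞) ^ (k + 1) ≤ E s ω}.indicator 1 ω := by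
        rw [Finset.sum_congr rfl hind]; simp
    _ ≤ levelCount E t ω := ENNReal.sum_le_tsum _

end

/-- An unbounded supremum suffices: if some `Ps`-e-process has `sup_t E_t = ∞` everywhere on `A`,
then some (possibly different) `Ps`-e-process tends to `∞` everywhere on `A`. -/
theorem eprocess_lim_of_unbounded_sup {Ω : Type*} {m : MeasurableSpace Ω} (F : Filtration ℕ m)
    (Ps : Set (Measure Ω)) (hprob : ∀ P ∈ Ps, IsProbabilityMeasure P) (A : Set Ω)
    (E : ℕ → Ω → ℝ≥0∞) (hE : IsEProcess F Ps E)
    (hsup : ∀ ω ∈ A, (⨆ t : ℕ, E t ω) = ⊤) :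
    ∃ E' : ℕ → Ω → ℝ≥0∞, IsEProcess F Ps E' ∧
      ∀ ω ∈ A, Filter.Tendsto (fun t => E' t ω) Filter.atTop (nhds ⊤) :=
  ⟨levelCount E, hE.levelCount, fun ω hω => tendsto_levelCount (hsup ω hω)⟩
end
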